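/- arXiv:1109.4544 — 9 statements merged into one kernel-verified Lean document; each statement's English description precedes it below -/
import Mathlib

section
/- Let L be a Lie algebra over ℝ, let z ∈ L, and let V ⊆ L be a linear subspace such that [v,w] = 0 for all v,w ∈ V and [v,[z,w]] ∈ V for all v,w ∈ V. Let C denote the Lie subalgebra of L generated by the set {ad_z^l(v) : v ∈ V, l ≥ 1}. Then the Lie subalgebra of L generated by {z} ∪ V is, as an ℝ-linear subspace, equal to ℝ·z + V + C. -/
namespace LieSubalgebra

variable {R L : Type*} [CommRing R] [LieRing L] [LieAlgebra R L]

/-- A Lie subalgebra generated by a set that `ad z` maps into it is stable under `ad z`. -/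
theorem lie_mem_lieSpan_of_forall_lie_mem {z : L} {s : Set L}
    (hs : ∀ x ∈ s, ⁅z, x⁆ ∈ lieSpan R L s) {x : L} (hx : x ∈ lieSpan R L s) :
    ⁅z, x⁆ ∈ lieSpan R L s := by
  induction hx using lieSpan_induction with
  | mem x hx => exact hs x hx
  | zero => simp
  | add x y _ _ hx hy => rw [lie_add]; exact add_mem hx hy
  | smul t x _ hx => rw [lie_smul]; exact (lieSpan R L s).smul_mem t hx
  | lie x y hx' hy' hx hy =>
    rw [leibniz_lie]
    exact add_mem (lie_mem _ hx hy') (lie_mem _ hx' hy)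

/-- If every element of `V` maps a generating set of a Lie subalgebra into the sum of `V` with
that subalgebra, then it maps the whole subalgebra into that sum. -/
theorem lie_mem_sup_lieSpan_of_forall_lie_mem {V : Submodule R L} {s : Set L}
    (hs : ∀ v ∈ V, ∀ x ∈ s, ⁅v, x⁆ ∈ V ⊔ (lieSpan R L s).toSubmodule)
    {v x : L} (hv : v ∈ V) (hx : x ∈ lieSpan R L s) :
    ⁅v, x⁆ ∈ V ⊔ (lieSpan R L s).toSubmodule := by
  induction hx using lieSpan_induction generalizing v with
  | mem x hx => exact hs v hv x hx
  | zero => simp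
  | add x y _ _ hx hy => rw [lie_add]; exact add_mem (hx hv) (hy hv)
  | smul t x _ hx => rw [lie_smul]; exact Submodule.smul_mem _ t (hx hv)
  | lie x y hx' hy' hx hy =>
    have key : ∀ {a b : L}, a ∈ V ⊔ (lieSpan R L s).toSubmodule → b ∈ lieSpan R L s →
        (∀ {w : L}, w ∈ V → ⁅w, b⁆ ∈ V ⊔ (lieSpan R L s).toSubmodule) →
        ⁅a, b⁆ ∈ V ⊔ (lieSpan R L s).toSubmodule := by
      intro a b ha hb hw
      obtain ⟨w, hwV, c, hc, rfl⟩ := Submodule.mem_sup.1 ha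
      rw [add_lie]
      exact add_mem (hw hwV) (Submodule.mem_sup_right (lie_mem _ hc hb))
    rw [leibniz_lie, ← lie_skew x]
    exact add_mem (key (hx hv) hy' hy) (neg_mem (key (hy hv) hx' hx))

variable (R) in
/-- The iterated brackets `ad_z^l v` with `v ∈ V` and `l ≥ 1`. -/
def iteratedBrackets (z : L) (V : Submodule R L) : Set L :=
  {x | ∃ l : ℕ, 1 ≤ l ∧ ∃ v ∈ V, ((LieAlgebra.ad R L z) ^ l) v = x}

variable {z : L} {V : Submodule R L}

theorem lie_mem_iteratedBrackets {v : L} (hv : v ∈ V) : ⁅z, v⁆ ∈ iteratedBrackets R z V :=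
  ⟨1, le_rfl, v, hv, by simp⟩

theorem lie_mem_lieSpan_iteratedBrackets {x : L}
    (hx : x ∈ lieSpan R L (iteratedBrackets R z V)) :
    ⁅z, x⁆ ∈ lieSpan R L (iteratedBrackets R z V) := by
  refine lie_mem_lieSpan_of_forall_lie_mem ?_ hx
  rintro _ ⟨l, -, v, hv, rfl⟩
  exact subset_lieSpan ⟨l + 1, by simp, v, hv, by rw [pow_succ']; rfl⟩

theorem lie_mem_lieSpan_iteratedBrackets_of_mem_sup {x : L}
    (hx : x ∈ V ⊔ (lieSpan R L (iteratedBrackets R z V)).toSubmodule) :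
    ⁅z, x⁆ ∈ lieSpan R L (iteratedBrackets R z V) := by
  obtain ⟨v, hv, c, hc, rfl⟩ := Submodule.mem_sup.1 hx
  rw [lie_add]
  exact add_mem (subset_lieSpan (lie_mem_iteratedBrackets hv))
    (lie_mem_lieSpan_iteratedBrackets hc)

theorem lie_mem_sup_lieSpan_iteratedBrackets (hsym : ∀ v ∈ V, ∀ w ∈ V, ⁅v, ⁅z, w⁆⁆ ∈ V)
    {v x : L} (hv : v ∈ V) (hx : x ∈ lieSpan R L (iteratedBrackets R z V)) :
    ⁅v, x⁆ ∈ V ⊔ (lieSpan R L (iteratedBrackets R z V)).toSubmodule := by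
  refine lie_mem_sup_lieSpan_of_forall_lie_mem ?_ hv hx
  rintro v hv _ ⟨l, hl, w, hw, rfl⟩
  induction l, hl using Nat.le_induction with
  | base => simpa using Submodule.mem_sup_left (hsym v hv w hw)
  | succ l hl ih =>
    rw [pow_succ', Module.End.mul_apply, LieAlgebra.ad_apply, leibniz_lie, ← lie_skew v z]
    refine Submodule.mem_sup_right (add_mem (lie_mem _ (neg_mem ?_) ?_) ?_)
    · exact subset_lieSpan (lie_mem_iteratedBrackets hv)
    · exact subset_lieSpan ⟨l, hl, w, hw, rfl⟩
    · exact lie_mem_lieSpan_iteratedBrackets_of_mem_sup ih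

theorem lie_mem_span_sup_sup_lieSpan (hcomm : ∀ v ∈ V, ∀ w ∈ V, ⁅v, w⁆ = 0)
    (hsym : ∀ v ∈ V, ∀ w ∈ V, ⁅v, ⁅z, w⁆⁆ ∈ V) {x y : L}
    (hx : x ∈ Submodule.span R {z} ⊔ V ⊔ (lieSpan R L (iteratedBrackets R z V)).toSubmodule)
    (hy : y ∈ Submodule.span R {z} ⊔ V ⊔ (lieSpan R L (iteratedBrackets R z V)).toSubmodule) :
    ⁅x, y⁆ ∈ Submodule.span R {z} ⊔ V ⊔
      (lieSpan R L (iteratedBrackets R z V)).toSubmodule := by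
  rw [sup_assoc] at hx hy ⊢
  obtain ⟨_, ha, p, hp, rfl⟩ := Submodule.mem_sup.1 hx
  obtain ⟨_, hb, q, hq, rfl⟩ := Submodule.mem_sup.1 hy
  obtain ⟨a, rfl⟩ := Submodule.mem_span_singleton.1 ha
  obtain ⟨b, rfl⟩ := Submodule.mem_span_singleton.1 hb
  have hzp := Submodule.mem_sup_right (S := V) (lie_mem_lieSpan_iteratedBrackets_of_mem_sup hp)
  have hzq := Submodule.mem_sup_right (S := V) (lie_mem_lieSpan_iteratedBrackets_of_mem_sup hq)
  have hpq : ⁅p, q⁆ ∈ V ⊔ (lieSpan R L (iteratedBrackets R z V)).toSubmodule := by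
    obtain ⟨v, hv, c, hc, rfl⟩ := Submodule.mem_sup.1 hp
    obtain ⟨w, hw, d, hd, rfl⟩ := Submodule.mem_sup.1 hq
    rw [add_lie, lie_add, lie_add, hcomm v hv w hw, zero_add, ← lie_skew c w]
    exact add_mem (lie_mem_sup_lieSpan_iteratedBrackets hsym hv hd)
      (add_mem (neg_mem (lie_mem_sup_lieSpan_iteratedBrackets hsym hw hc))
        (Submodule.mem_sup_right (lie_mem _ hc hd)))
  refine Submodule.mem_sup_right ?_
  have key : ⁅a • z + p, b • z + q⁆ = a • ⁅z, q⁆ - b • ⁅z, p⁆ + ⁅p, q⁆ := by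
    simp only [add_lie, lie_add, smul_lie, lie_smul, lie_self, smul_zero]
    rw [← lie_skew p z, zero_add, smul_neg]
    abel
  rw [key]
  exact add_mem (sub_mem (Submodule.smul_mem _ a hzq) (Submodule.smul_mem _ b hzp)) hpq

theorem ad_pow_apply_mem {K : LieSubalgebra R L} {x y : L} (hx : x ∈ K) (hy : y ∈ K) (l : ℕ) :
    ((LieAlgebra.ad R L x) ^ l) y ∈ K := by
  induction l with
  | zero => simpa
  | succ l ih => rw [pow_succ']; exact lie_mem _ hx ih

end LieSubalgebra


/-- Primitive-bracket decomposition of the accessibility algebra: if `V` is an abelian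
subspace with `⁅v, ⁅z, w⁆⁆ ∈ V` for `v, w ∈ V`, and `C` is the Lie subalgebra generated by
the iterated brackets `ad_z^l v` (`l ≥ 1`, `v ∈ V`), then the Lie subalgebra generated by
`{z} ∪ V` equals `ℝ·z + V + C` as an `ℝ`-linear subspace. -/
theorem stmt_0 {L : Type*} [LieRing L] [LieAlgebra ℝ L] (z : L) (V : Submodule ℝ L)
    (hcomm : ∀ v ∈ V, ∀ w ∈ V, ⁅v, w⁆ = 0)
    (hsym : ∀ v ∈ V, ∀ w ∈ V, ⁅v, ⁅z, w⁆⁆ ∈ V)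
    (C : LieSubalgebra ℝ L)
    (hC : C = LieSubalgebra.lieSpan ℝ L
      {x | ∃ l : ℕ, 1 ≤ l ∧ ∃ v ∈ V, ((LieAlgebra.ad ℝ L z) ^ l) v = x}) :
    (LieSubalgebra.lieSpan ℝ L (insert z (V : Set L))).toSubmodule
      = Submodule.span ℝ {z} ⊔ V ⊔ C.toSubmodule := by
  subst hC
  apply le_antisymm
  · let K : LieSubalgebra ℝ L :=
      { Submodule.span ℝ {z} ⊔ V ⊔
          (LieSubalgebra.lieSpan ℝ L (LieSubalgebra.iteratedBrackets ℝ z V)).toSubmodule with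
        lie_mem' := LieSubalgebra.lie_mem_span_sup_sup_lieSpan hcomm hsym }
    have hK : LieSubalgebra.lieSpan ℝ L (insert z (V : Set L)) ≤ K := by
      rw [LieSubalgebra.lieSpan_le, Set.insert_subset_iff]
      exact ⟨Submodule.mem_sup_left (Submodule.mem_sup_left (Submodule.mem_span_singleton_self z)),
        fun v hv => Submodule.mem_sup_left (Submodule.mem_sup_right hv)⟩
    exact hK
  · have hz : z ∈ LieSubalgebra.lieSpan ℝ L (insert z (V : Set L)) :=
      LieSubalgebra.subset_lieSpan (Set.mem_insert _ _)
    have hV : ∀ v ∈ V, v ∈ LieSubalgebra.lieSpan ℝ L (insert z (V : Set L)) := fun v hv =>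
      LieSubalgebra.subset_lieSpan (Set.mem_insert_of_mem _ hv)
    refine sup_le (sup_le ?_ hV) ?_
    · rwa [Submodule.span_singleton_le_iff_mem]
    · rw [LieSubalgebra.toSubmodule_le_toSubmodule, LieSubalgebra.lieSpan_le]
      rintro _ ⟨l, -, v, hv, rfl⟩
      exact LieSubalgebra.ad_pow_apply_mem hz (hV v hv) l
end

section
/- Let L be a Lie algebra over ℝ, let z ∈ L, and let V ⊆ L be a linear subspace such that [v,w] = 0 for all v,w ∈ V and [v,[z,w]] ∈ V for all v,w ∈ V. Let C denote the Lie subalgebra of L generated by {ad_z^l(v) : v ∈ V, l ≥ 1}. Then the linear subspace ℝ·z + V + C is closed under the Lie bracket, i.e., it is a Lie subalgebra of L. -/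
/-- If a Lie bracket by `z` sends each element of `s` into the Lie subalgebra generated by `s`, then
it preserves this subalgebra. -/
theorem LieSubalgebra.lie_mem_lieSpan_of_forall_mem {R L : Type*} [CommRing R] [LieRing L]
    [LieAlgebra R L] {s : Set L} {z : L} (h : ∀ x ∈ s, ⁅z, x⁆ ∈ LieSubalgebra.lieSpan R L s)
    {x : L} (hx : x ∈ LieSubalgebra.lieSpan R L s) : ⁅z, x⁆ ∈ LieSubalgebra.lieSpan R L s := by
  induction hx using LieSubalgebra.lieSpan_induction with
  | mem x hx => exact h x hx
  | zero => simp
  | add x y _ _ ihx ihy => rw [lie_add]; exact add_mem ihx ihy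
  | smul a x _ ih => rw [lie_smul]; exact LieSubalgebra.smul_mem _ a ih
  | lie x y hx hy ihx ihy =>
    rw [leibniz_lie]
    exact add_mem (LieSubalgebra.lie_mem _ ihx hy) (LieSubalgebra.lie_mem _ hx ihy)

/-- If brackets of a submodule `V` with each element of `s` lie in `V + lieSpan s`, then so do brackets
of `V` with each element of `lieSpan s`. -/
theorem LieSubalgebra.lie_mem_sup_lieSpan_of_forall_mem {R L : Type*} [CommRing R] [LieRing L]
    [LieAlgebra R L] {s : Set L} {V : Submodule R L}
    (h : ∀ x ∈ s, ∀ v ∈ V, ⁅v, x⁆ ∈ V ⊔ (LieSubalgebra.lieSpan R L s).toSubmodule)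
    {x : L} (hx : x ∈ LieSubalgebra.lieSpan R L s) :
    ∀ v ∈ V, ⁅v, x⁆ ∈ V ⊔ (LieSubalgebra.lieSpan R L s).toSubmodule := by
  induction hx using LieSubalgebra.lieSpan_induction with
  | mem x hx => exact h x hx
  | zero => simp
  | add x y _ _ ihx ihy =>
    intro v hv
    rw [lie_add]
    exact add_mem (ihx v hv) (ihy v hv)
  | smul a x _ ih =>
    intro v hv
    rw [lie_smul]
    exact Submodule.smul_mem _ a (ih v hv)
  | lie x y hx hy ihx ihy =>
    intro v hv
    obtain ⟨v₁, hv₁, c₁, hc₁, h₁⟩ := Submodule.mem_sup.1 (ihx v hv)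
    obtain ⟨v₂, hv₂, c₂, hc₂, h₂⟩ := Submodule.mem_sup.1 (ihy v hv)
    rw [leibniz_lie, ← h₁, ← h₂, add_lie, lie_add, ← lie_skew x v₂]
    exact add_mem
      (add_mem (ihy v₁ hv₁) (Submodule.mem_sup_right (LieSubalgebra.lie_mem _ hc₁ hy)))
      (add_mem (neg_mem (ihx v₂ hv₂)) (Submodule.mem_sup_right (LieSubalgebra.lie_mem _ hx hc₂)))


/-- If `V` is an abelian subspace with `⁅v, ⁅z, w⁆⁆ ∈ V` for `v, w ∈ V`, and `C` is the Lie
subalgebra generated by the iterated brackets `ad_z^l v` (`l ≥ 1`, `v ∈ V`), then the linear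
subspace `ℝ·z + V + C` is closed under the Lie bracket. -/
theorem stmt_1 {L : Type*} [LieRing L] [LieAlgebra ℝ L] (z : L) (V : Submodule ℝ L)
    (hcomm : ∀ v ∈ V, ∀ w ∈ V, ⁅v, w⁆ = 0)
    (hsym : ∀ v ∈ V, ∀ w ∈ V, ⁅v, ⁅z, w⁆⁆ ∈ V)
    (C : LieSubalgebra ℝ L)
    (hC : C = LieSubalgebra.lieSpan ℝ L
      {x | ∃ l : ℕ, 1 ≤ l ∧ ∃ v ∈ V, ((LieAlgebra.ad ℝ L z) ^ l) v = x}) :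
    ∀ x ∈ Submodule.span ℝ {z} ⊔ V ⊔ C.toSubmodule,
      ∀ y ∈ Submodule.span ℝ {z} ⊔ V ⊔ C.toSubmodule,
        ⁅x, y⁆ ∈ Submodule.span ℝ {z} ⊔ V ⊔ C.toSubmodule := by
  have mem_ad (n : ℕ) (v : L) (hv : v ∈ V) : ((LieAlgebra.ad ℝ L z) ^ (n + 1)) v ∈ C := by
    rw [hC]
    exact LieSubalgebra.subset_lieSpan ⟨n + 1, by lia, v, hv, rfl⟩
  have ad_succ (n : ℕ) (v : L) :
      ((LieAlgebra.ad ℝ L z) ^ (n + 1)) v = ⁅z, ((LieAlgebra.ad ℝ L z) ^ n) v⁆ := by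
    rw [pow_succ', Module.End.mul_apply, LieAlgebra.ad_apply]
  have lie_zV (v : L) (hv : v ∈ V) : ⁅z, v⁆ ∈ C := by
    simpa using mem_ad 0 v hv
  have lie_zC (c : L) (hc : c ∈ C) : ⁅z, c⁆ ∈ C := by
    subst hC
    refine LieSubalgebra.lie_mem_lieSpan_of_forall_mem ?_ hc
    rintro _ ⟨l, -, v, hv, rfl⟩
    rw [← ad_succ]
    exact mem_ad l v hv
  have lie_V_ad (n : ℕ) (w : L) (hw : w ∈ V) (v : L) (hv : v ∈ V) :
      ⁅v, ((LieAlgebra.ad ℝ L z) ^ (n + 1)) w⁆ ∈ V ⊔ C.toSubmodule := by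
    induction n with
    | zero => simpa using Submodule.mem_sup_left (hsym v hv w hw)
    | succ n ih =>
      obtain ⟨v', hv', c, hc, h⟩ := Submodule.mem_sup.1 ih
      have key : ⁅v, ((LieAlgebra.ad ℝ L z) ^ (n + 1 + 1)) w⁆ =
          ⁅z, v'⁆ + ⁅z, c⁆ - ⁅⁅z, v⁆, ((LieAlgebra.ad ℝ L z) ^ (n + 1)) w⁆ := by
        rw [ad_succ (n + 1), ← lie_add, h, leibniz_lie z v]
        abel
      rw [key]
      exact Submodule.mem_sup_right (sub_mem (add_mem (lie_zV v' hv') (lie_zC c hc))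
        (C.lie_mem (lie_zV v hv) (mem_ad n w hw)))
  have lie_VC (v : L) (hv : v ∈ V) (c : L) (hc : c ∈ C) : ⁅v, c⁆ ∈ V ⊔ C.toSubmodule := by
    subst hC
    refine LieSubalgebra.lie_mem_sup_lieSpan_of_forall_mem ?_ hc v hv
    rintro _ ⟨l, hl, w, hw, rfl⟩ v hv
    obtain ⟨n, rfl⟩ := Nat.exists_eq_add_of_le' hl
    exact lie_V_ad n w hw v hv
  intro x hx y hy
  rw [sup_assoc] at hx hy ⊢
  obtain ⟨_, hz₁, _, hvc₁, rfl⟩ := Submodule.mem_sup.1 hx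
  obtain ⟨_, hz₂, _, hvc₂, rfl⟩ := Submodule.mem_sup.1 hy
  obtain ⟨a, rfl⟩ := Submodule.mem_span_singleton.1 hz₁
  obtain ⟨b, rfl⟩ := Submodule.mem_span_singleton.1 hz₂
  obtain ⟨v, hv, c, hc, rfl⟩ := Submodule.mem_sup.1 hvc₁
  obtain ⟨w, hw, d, hd, rfl⟩ := Submodule.mem_sup.1 hvc₂
  apply Submodule.mem_sup_right
  have key : ⁅a • z + (v + c), b • z + (w + d)⁆ =
      (a • (⁅z, w⁆ + ⁅z, d⁆) - b • (⁅z, v⁆ + ⁅z, c⁆) + ⁅c, d⁆) + (⁅v, d⁆ - ⁅w, c⁆) := by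
    simp only [add_lie, lie_add, smul_lie, lie_smul, lie_self, hcomm v hv w hw, ← lie_skew z v,
      ← lie_skew z c, ← lie_skew w c, smul_add, smul_neg, smul_zero]
    abel
  rw [key]
  refine add_mem (Submodule.mem_sup_right ?_) (sub_mem (lie_VC v hv d hd) (lie_VC w hw c hc))
  exact add_mem (sub_mem (C.smul_mem a (add_mem (lie_zV w hw) (lie_zC d hd)))
    (C.smul_mem b (add_mem (lie_zV v hv) (lie_zC c hc)))) (C.lie_mem hc hd)
end

section
/- Let L be a Lie algebra over ℝ, let z ∈ L, and let V ⊆ L be a linear subspace such that [v,w] = 0 for all v,w ∈ V and [v,[z,w]] ∈ V for all v,w ∈ V. Let C denote the Lie subalgebra of L generated by {ad_z^l(v) : v ∈ V, l ≥ 1}. Then [v,c] ∈ V + C for every v ∈ V and every c ∈ C. -/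
/-- If a derivation maps a set into the Lie subalgebra that the set generates, it preserves this
subalgebra. -/
theorem LieDerivation.apply_mem_lieSpan {R L : Type*} [CommRing R] [LieRing L] [LieAlgebra R L]
    (D : LieDerivation R L L) {s : Set L} (hs : ∀ x ∈ s, D x ∈ LieSubalgebra.lieSpan R L s)
    {x : L} (hx : x ∈ LieSubalgebra.lieSpan R L s) : D x ∈ LieSubalgebra.lieSpan R L s := by
  induction hx using LieSubalgebra.lieSpan_induction with
  | mem x h => exact hs x h
  | zero => simp
  | add x y _ _ ihx ihy => rw [map_add]; exact add_mem ihx ihy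
  | smul a x _ ih => rw [map_smul]; exact LieSubalgebra.smul_mem _ a ih
  | lie x y hx hy ihx ihy =>
    rw [LieDerivation.apply_lie_eq_add]
    exact add_mem (LieSubalgebra.lie_mem _ hx ihy) (LieSubalgebra.lie_mem _ ihx hy)

/-- If brackets of elements of `V` with the generators `s` lie in `V + C`, where `C` is the Lie
subalgebra generated by `s`, then so do brackets of elements of `V` with elements of `C`. -/
theorem LieSubalgebra.lie_mem_sup_lieSpan {R L : Type*} [CommRing R] [LieRing L] [LieAlgebra R L]
    (V : Submodule R L) {s : Set L}
    (hs : ∀ x ∈ s, ∀ v ∈ V, ⁅v, x⁆ ∈ V ⊔ (LieSubalgebra.lieSpan R L s).toSubmodule)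
    {c : L} (hc : c ∈ LieSubalgebra.lieSpan R L s) :
    ∀ v ∈ V, ⁅v, c⁆ ∈ V ⊔ (LieSubalgebra.lieSpan R L s).toSubmodule := by
  have lie_mem_of_mem_sup {x y : L}
      (hx : x ∈ V ⊔ (LieSubalgebra.lieSpan R L s).toSubmodule)
      (hy : y ∈ LieSubalgebra.lieSpan R L s)
      (ihy : ∀ v ∈ V, ⁅v, y⁆ ∈ V ⊔ (LieSubalgebra.lieSpan R L s).toSubmodule) :
      ⁅x, y⁆ ∈ V ⊔ (LieSubalgebra.lieSpan R L s).toSubmodule := by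
    obtain ⟨u, hu, d, hd, rfl⟩ := Submodule.mem_sup.1 hx
    rw [add_lie]
    exact add_mem (ihy u hu) (Submodule.mem_sup_right (LieSubalgebra.lie_mem _ hd hy))
  induction hc using LieSubalgebra.lieSpan_induction with
  | mem x h => exact hs x h
  | zero => simp
  | add x y _ _ ihx ihy =>
    intro v hv
    rw [lie_add]
    exact add_mem (ihx v hv) (ihy v hv)
  | smul a x _ ih =>
    intro v hv
    rw [lie_smul]
    exact Submodule.smul_mem _ a (ih v hv)
  | lie x y hx hy ihx ihy =>
    intro v hv
    rw [leibniz_lie, ← lie_skew x]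
    exact add_mem (lie_mem_of_mem_sup (ihx v hv) hy ihy)
      (neg_mem (lie_mem_of_mem_sup (ihy v hv) hx ihx))

/-- If `V` is an abelian subspace with `⁅v, ⁅z, w⁆⁆ ∈ V` for `v, w ∈ V`, and `C` is the Lie
subalgebra generated by the iterated brackets `ad_z^l v` (`l ≥ 1`, `v ∈ V`), then
`⁅v, c⁆ ∈ V + C` for every `v ∈ V` and `c ∈ C`. -/
theorem stmt_2 {L : Type*} [LieRing L] [LieAlgebra ℝ L] (z : L) (V : Submodule ℝ L)
    (hcomm : ∀ v ∈ V, ∀ w ∈ V, ⁅v, w⁆ = 0)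
    (hsym : ∀ v ∈ V, ∀ w ∈ V, ⁅v, ⁅z, w⁆⁆ ∈ V)
    (C : LieSubalgebra ℝ L)
    (hC : C = LieSubalgebra.lieSpan ℝ L
      {x | ∃ l : ℕ, 1 ≤ l ∧ ∃ v ∈ V, ((LieAlgebra.ad ℝ L z) ^ l) v = x}) :
    ∀ v ∈ V, ∀ c ∈ C, ⁅v, c⁆ ∈ V ⊔ C.toSubmodule := by
  subst hC
  set s : Set L := {x | ∃ l : ℕ, 1 ≤ l ∧ ∃ v ∈ V, ((LieAlgebra.ad ℝ L z) ^ l) v = x}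
  have ad_pow_succ (l : ℕ) (v : L) :
      ((LieAlgebra.ad ℝ L z) ^ (l + 1)) v = ⁅z, ((LieAlgebra.ad ℝ L z) ^ l) v⁆ := by
    rw [pow_succ', Module.End.mul_apply, LieAlgebra.ad_apply]
  have ad_pow_mem (l : ℕ) (hl : 1 ≤ l) (v : L) (hv : v ∈ V) :
      ((LieAlgebra.ad ℝ L z) ^ l) v ∈ LieSubalgebra.lieSpan ℝ L s :=
    LieSubalgebra.subset_lieSpan ⟨l, hl, v, hv, rfl⟩
  have lie_z_mem_of_mem (v : L) (hv : v ∈ V) : ⁅z, v⁆ ∈ LieSubalgebra.lieSpan ℝ L s := by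
    simpa using ad_pow_mem 1 le_rfl v hv
  have lie_z_mem {x : L} (hx : x ∈ LieSubalgebra.lieSpan ℝ L s) :
      ⁅z, x⁆ ∈ LieSubalgebra.lieSpan ℝ L s := by
    have h := (LieDerivation.ad ℝ L z).apply_mem_lieSpan (s := s) ?_ hx
    · simpa using h
    · rintro _ ⟨l, -, v, hv, rfl⟩
      simpa [ad_pow_succ] using ad_pow_mem (l + 1) (by omega) v hv
  intro v hv c hc
  refine LieSubalgebra.lie_mem_sup_lieSpan V ?_ hc v hv
  rintro _ ⟨l, hl, w, hw, rfl⟩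
  induction l, hl using Nat.le_induction with
  | base =>
    intro v hv
    simpa using Submodule.mem_sup_left (hsym v hv w hw)
  | succ l hl ih =>
    intro v hv
    obtain ⟨u, hu, d, hd, hud⟩ := Submodule.mem_sup.1 (ih v hv)
    have key : ⁅v, ((LieAlgebra.ad ℝ L z) ^ (l + 1)) w⁆ =
        ⁅z, u⁆ + ⁅z, d⁆ - ⁅⁅z, v⁆, ((LieAlgebra.ad ℝ L z) ^ l) w⁆ := by
      rw [ad_pow_succ, ← lie_add, hud, leibniz_lie z v, add_sub_cancel_left]
    rw [key]
    exact Submodule.mem_sup_right (sub_mem (add_mem (lie_z_mem_of_mem u hu) (lie_z_mem hd))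
      (LieSubalgebra.lie_mem _ (lie_z_mem_of_mem v hv) (ad_pow_mem l hl w hw)))
end

section
/- Let L be a Lie algebra over a field k and let S ⊆ L be a subset. Then the Lie subalgebra of L generated by S coincides, as a k-linear subspace, with the linear span of all left-nested iterated brackets [w_k,[w_{k-1},[…,[w_2,w_1]…]]] with k ≥ 1 and w_1,…,w_k ∈ S. -/
/-- Left-nested iterated brackets of elements of `S`: `leftNested S n` consists of brackets
`⁅w_{n+1}, ⁅…, ⁅w₂, w₁⁆…⁆⁆` of length `n + 1` with all `w_i ∈ S`. -/
def leftNested {L : Type*} [LieRing L] (S : Set L) : ℕ → Set L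
  | 0 => S
  | n + 1 => {x | ∃ w ∈ S, ∃ y ∈ leftNested S n, x = ⁅w, y⁆}

theorem leftNested_subset_lieSpan {k : Type*} [Field k] {L : Type*} [LieRing L] [LieAlgebra k L]
    (S : Set L) (n : ℕ) : leftNested S n ⊆ LieSubalgebra.lieSpan k L S := by
  induction n with
  | zero => exact LieSubalgebra.subset_lieSpan
  | succ n ih =>
    rintro _ ⟨w, hw, y, hy, rfl⟩
    exact LieSubalgebra.lie_mem _ (LieSubalgebra.subset_lieSpan hw) (ih hy)

/-- The span of the left-nested brackets is stable under the adjoint action of the generators. -/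
theorem lie_mem_span_leftNested {k : Type*} [Field k] {L : Type*} [LieRing L] [LieAlgebra k L]
    {S : Set L} {w y : L} (hw : w ∈ S) (hy : y ∈ Submodule.span k (⋃ n : ℕ, leftNested S n)) :
    ⁅w, y⁆ ∈ Submodule.span k (⋃ n : ℕ, leftNested S n) := by
  induction hy using Submodule.span_induction with
  | mem y hy =>
    obtain ⟨n, hn⟩ := Set.mem_iUnion.mp hy
    exact Submodule.subset_span (Set.mem_iUnion.mpr ⟨n + 1, w, hw, y, hn, rfl⟩)
  | zero => simp
  | add x y _ _ hx hy => rw [lie_add]; exact add_mem hx hy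
  | smul a x _ hx => rw [lie_smul]; exact Submodule.smul_mem _ a hx

/-- The span of the left-nested brackets is stable under the adjoint action of the generated
Lie subalgebra. -/
theorem lie_mem_span_leftNested_of_mem_lieSpan {k : Type*} [Field k] {L : Type*} [LieRing L]
    [LieAlgebra k L] {S : Set L} {x y : L} (hx : x ∈ LieSubalgebra.lieSpan k L S)
    (hy : y ∈ Submodule.span k (⋃ n : ℕ, leftNested S n)) :
    ⁅x, y⁆ ∈ Submodule.span k (⋃ n : ℕ, leftNested S n) := by
  induction hx using LieSubalgebra.lieSpan_induction generalizing y with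
  | mem x hx => exact lie_mem_span_leftNested hx hy
  | zero => simp
  | add u v _ _ hu hv => rw [add_lie]; exact add_mem (hu hy) (hv hy)
  | smul a u _ hu => rw [smul_lie]; exact Submodule.smul_mem _ a (hu hy)
  | lie u v _ _ hu hv => rw [lie_lie]; exact sub_mem (hu (hv hy)) (hv (hu hy))

/-- The Lie subalgebra generated by a subset `S` of a Lie algebra over a field `k` coincides,
as a `k`-linear subspace, with the linear span of all left-nested iterated brackets of
elements of `S`. -/
theorem stmt_4 {k : Type*} [Field k] {L : Type*} [LieRing L] [LieAlgebra k L] (S : Set L) :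
    (LieSubalgebra.lieSpan k L S).toSubmodule = Submodule.span k (⋃ n : ℕ, leftNested S n) := by
  have hle : Submodule.span k (⋃ n : ℕ, leftNested S n) ≤
      (LieSubalgebra.lieSpan k L S).toSubmodule :=
    Submodule.span_le.mpr (Set.iUnion_subset (leftNested_subset_lieSpan S))
  refine le_antisymm ?_ hle
  let K : LieSubalgebra k L :=
    { Submodule.span k (⋃ n : ℕ, leftNested S n) with
      lie_mem' := fun hx hy => lie_mem_span_leftNested_of_mem_lieSpan (hle hx) hy }
  have hK : LieSubalgebra.lieSpan k L S ≤ K :=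
    LieSubalgebra.lieSpan_le.mpr fun x hx =>
      Submodule.subset_span (Set.mem_iUnion.mpr ⟨0, hx⟩)
  exact hK
end

section
/- Define integers A_j^{(k)} for k ≥ 2 and 0 ≤ j ≤ k−1 by: A_0^{(k)} = 1 for all k; A_1^{(2)} = 1; and for k ≥ 2, A_1^{(k+1)} = A_1^{(k)}, A_j^{(k+1)} = A_j^{(k)} + A_{j-1}^{(k)} for 2 ≤ j ≤ k−1, and A_k^{(k+1)} = k. Then in any Lie ring L, for all elements y, z, w ∈ L and every integer k ≥ 2, the identity [y, ad_z^k(w)] = Σ_{j=1}^{k−1} A_j^{(k)} · [ad_z^j(w), ad_z^{k−j}(y)] + ad_z^{k−1}([y,[z,w]]) holds. -/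
/-- A Pascal-type recurrence between two coefficient families `a` and `b` shifts a weighted sum of
consecutive terms `F (i + 1) + F i` into a weighted sum of the single terms `F i`. -/
theorem sum_range_smul_add_succ {M : Type*} [AddCommGroup M] (a b : ℕ → ℤ) (F : ℕ → M) (m : ℕ)
    (h_zero : b 0 = a 0) (h_mid : ∀ i < m, b (i + 1) = a (i + 1) + a i)
    (h_top : b (m + 1) = a m + 1) :
    ∑ i ∈ Finset.range (m + 2), b i • F i
      = ∑ i ∈ Finset.range (m + 1), a i • (F (i + 1) + F i) + F (m + 1) := by
  have h : ∑ i ∈ Finset.range m, b (i + 1) • F (i + 1)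
      = ∑ i ∈ Finset.range m, a (i + 1) • F (i + 1) + ∑ i ∈ Finset.range m, a i • F (i + 1) := by
    rw [← Finset.sum_add_distrib]
    refine Finset.sum_congr rfl fun i hi => ?_
    rw [h_mid i (Finset.mem_range.mp hi), add_smul]
  simp only [smul_add, Finset.sum_add_distrib]
  rw [Finset.sum_range_succ', Finset.sum_range_succ, h,
    Finset.sum_range_succ (fun i => a i • F (i + 1)), Finset.sum_range_succ' (fun i => a i • F i),
    h_zero, h_top, add_smul, one_smul]
  abel

/-- A sum over `1, …, n` as a sum over a range. -/
theorem sum_Icc_one_eq_sum_range {M : Type*} [AddCommMonoid M] (f : ℕ → M) (n : ℕ) :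
    ∑ j ∈ Finset.Icc 1 n, f j = ∑ i ∈ Finset.range n, f (i + 1) := by
  induction n with
  | zero => simp
  | succ n ih => rw [Finset.sum_Icc_succ_top (by omega), ih, Finset.sum_range_succ]

/-- The key combinatorial bracket identity: with the coefficients `A_j^{(k)}` defined by the
recurrence `A_0^{(k)} = 1`, `A_1^{(2)} = 1`, `A_1^{(k+1)} = A_1^{(k)}`,
`A_j^{(k+1)} = A_j^{(k)} + A_{j-1}^{(k)}` for `2 ≤ j ≤ k-1`, and `A_k^{(k+1)} = k`,
one has `⁅y, ad_z^k w⁆ = ∑_{j=1}^{k-1} A_j^{(k)} • ⁅ad_z^j w, ad_z^{k-j} y⁆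
+ ad_z^{k-1} ⁅y, ⁅z, w⁆⁆` for all `k ≥ 2`. -/
theorem stmt_7 {L : Type*} [LieRing L] (A : ℕ → ℕ → ℤ)
    (hA0 : ∀ k, 2 ≤ k → A k 0 = 1)
    (hA21 : A 2 1 = 1)
    (hA1 : ∀ k, 2 ≤ k → A (k + 1) 1 = A k 1)
    (hArec : ∀ k, 2 ≤ k → ∀ j, 2 ≤ j → j ≤ k - 1 → A (k + 1) j = A k j + A k (j - 1))
    (hAtop : ∀ k, 2 ≤ k → A (k + 1) k = (k : ℤ))
    (y z w : L) (k : ℕ) (hk : 2 ≤ k) :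
    ⁅y, (fun x => ⁅z, x⁆)^[k] w⁆
      = (∑ j ∈ Finset.Icc 1 (k - 1),
          A k j • ⁅(fun x => ⁅z, x⁆)^[j] w, (fun x => ⁅z, x⁆)^[k - j] y⁆)
        + (fun x => ⁅z, x⁆)^[k - 1] ⁅y, ⁅z, w⁆⁆ := by
  obtain ⟨m, rfl⟩ := Nat.exists_eq_add_of_le' hk
  clear hk
  induction m with
  | zero =>
    suffices ⁅y, ⁅z, ⁅z, w⁆⁆⁆ = ⁅⁅z, w⁆, ⁅z, y⁆⁆ + ⁅z, ⁅y, ⁅z, w⁆⁆⁆ by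
      simp only [Nat.reduceSub, zero_add, Finset.Icc_self, Finset.sum_singleton,
        hA21, one_smul]
      exact this
    rw [leibniz_lie z y, ← lie_skew ⁅z, y⁆]
    abel
  | succ m ih =>
    have h_diag : A (m + 2) (m + 1) = (m : ℤ) + 1 := by
      rcases m with _ | m
      · simpa using hA21
      · exact_mod_cast hAtop (m + 2) (by omega)
    have h_sum := sum_range_smul_add_succ (fun i => A (m + 2) (i + 1)) (fun i => A (m + 3) (i + 1))
      (fun i => ⁅(fun x => ⁅z, x⁆)^[i + 1] w, (fun x => ⁅z, x⁆)^[m + 2 - i] y⁆) m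
      (hA1 (m + 2) (by omega))
      (fun i hi => hArec (m + 2) (by omega) (i + 2) (by omega) (by omega))
      (by have := hAtop (m + 2) (by omega)
          simp only [h_diag]
          push_cast at this
          linarith)
    have h_leibniz : ⁅y, (fun x => ⁅z, x⁆)^[m + 3] w⁆
        = ⁅z, ⁅y, (fun x => ⁅z, x⁆)^[m + 2] w⁆⁆ + ⁅(fun x => ⁅z, x⁆)^[m + 2] w, ⁅z, y⁆⁆ := by
      rw [Function.iterate_succ_apply' _ (m + 2), leibniz_lie z y,
        ← lie_skew ⁅z, y⁆]
      abel
    have h_terms : ∀ i ∈ Finset.range (m + 1),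
        ⁅z, A (m + 2) (i + 1) •
            ⁅(fun x => ⁅z, x⁆)^[i + 1] w, (fun x => ⁅z, x⁆)^[m + 2 - (i + 1)] y⁆⁆
          = A (m + 2) (i + 1) •
            (⁅(fun x => ⁅z, x⁆)^[i + 1 + 1] w, (fun x => ⁅z, x⁆)^[m + 2 - (i + 1)] y⁆
              + ⁅(fun x => ⁅z, x⁆)^[i + 1] w, (fun x => ⁅z, x⁆)^[m + 2 - i] y⁆) := by
      intro i hi
      have hi' := Finset.mem_range.mp hi
      rw [lie_zsmul, leibniz_lie z, show m + 2 - i = (m + 2 - (i + 1)) + 1 by omega,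
        Function.iterate_succ_apply' _ (i + 1), Function.iterate_succ_apply' _ (m + 2 - (i + 1))]
    rw [sum_Icc_one_eq_sum_range] at ih ⊢
    simp only [show m + 1 + 2 = m + 3 by omega, show m + 3 - 1 = m + 2 by omega,
      show m + 2 - 1 = m + 1 by omega, Nat.reduceSubDiff] at ih ⊢ h_terms
    rw [h_leibniz, ih, lie_add, lie_sum]
    simp only [Nat.reduceSubDiff] at h_sum h_terms ⊢
    rw [Finset.sum_congr rfl h_terms, h_sum, Function.iterate_succ_apply' _ (m + 1) ⁅y, ⁅z, w⁆⁆,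
      Nat.add_sub_cancel_left, Function.iterate_one]
    exact add_right_comm _ _ _
end

section
/- Let E be a finite-dimensional real normed vector space. Let Y_1 be a C¹ vector field and Y_2 a C² vector field on E. Define on E × E the vector fields Z(q,v) = (v,0), Y_1^V(q,v) = (0, Y_1(q)), Y_2^V(q,v) = (0, Y_2(q)). Then [Y_1^V, [Z, Y_2^V]](q,v) = (0, ⟨Y_1 : Y_2⟩(q)) for all (q,v) ∈ E × E, where ⟨Y_1 : Y_2⟩(q) = D(Y_2)_q(Y_1(q)) + D(Y_1)_q(Y_2(q)) is the symmetric product with respect to the flat connection. -/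
theorem HasFDerivAt.verticalLift {E F : Type*} [NormedAddCommGroup E] [NormedSpace ℝ E]
    [NormedAddCommGroup F] [NormedSpace ℝ F] {Y : E → F} {Y' : E →L[ℝ] F} {p : E × E}
    (hY : HasFDerivAt Y Y' p.1) :
    HasFDerivAt (fun p : E × E => ((0 : E), Y p.1))
      ((0 : E × E →L[ℝ] E).prod (Y'.comp (ContinuousLinearMap.fst ℝ E E))) p :=
  (hasFDerivAt_const (0 : E) p).prodMk (hY.comp p hasFDerivAt_fst)

theorem lieBracket_flatSpray_verticalLift {E : Type*} [NormedAddCommGroup E] [NormedSpace ℝ E]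
    {Y : E → E} (hY : Differentiable ℝ Y) :
    VectorField.lieBracket ℝ (fun p : E × E => (p.2, (0 : E))) (fun p : E × E => ((0 : E), Y p.1))
      = fun p : E × E => (-Y p.1, fderiv ℝ Y p.1 p.2) := by
  ext1 p
  have hZ : HasFDerivAt (fun p : E × E => (p.2, (0 : E)))
      ((ContinuousLinearMap.snd ℝ E E).prod (0 : E × E →L[ℝ] E)) p :=
    hasFDerivAt_snd.prodMk (hasFDerivAt_const (0 : E) p)
  simp [VectorField.lieBracket, (hY p.1).hasFDerivAt.verticalLift.fderiv, hZ.fderiv]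

/-- The vertical lift of the symmetric product of the flat connection:
`[Y₁^V, [Z, Y₂^V]](q,v) = (0, D(Y₂)_q (Y₁ q) + D(Y₁)_q (Y₂ q))`. -/
theorem stmt_10 {E : Type*} [NormedAddCommGroup E] [NormedSpace ℝ E] [FiniteDimensional ℝ E]
    (Y₁ Y₂ : E → E) (hY₁ : ContDiff ℝ 1 Y₁) (hY₂ : ContDiff ℝ 2 Y₂) (q v : E) :
    VectorField.lieBracket ℝ (fun p : E × E => ((0 : E), Y₁ p.1))
      (VectorField.lieBracket ℝ (fun p : E × E => (p.2, (0 : E)))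
        (fun p : E × E => ((0 : E), Y₂ p.1))) (q, v)
      = ((0 : E), fderiv ℝ Y₂ q (Y₁ q) + fderiv ℝ Y₁ q (Y₂ q)) := by
  have hd₁ : Differentiable ℝ Y₁ := hY₁.differentiable (by norm_num)
  have hd₂ : Differentiable ℝ Y₂ := hY₂.differentiable (by norm_num)
  have hdd₂ : Differentiable ℝ (fderiv ℝ Y₂) :=
    (hY₂.fderiv_right (m := 1) (by norm_num)).differentiable (by norm_num)
  have hlift : HasFDerivAt (fun p : E × E => ((0 : E), Y₁ p.1)) _ (q, v) :=
    (hd₁ q).hasFDerivAt.verticalLift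
  have hbase : HasFDerivAt (fun p : E × E => Y₂ p.1) _ (q, v) :=
    (hd₂ q).hasFDerivAt.comp (q, v) hasFDerivAt_fst
  have hfiber : HasFDerivAt (fun p : E × E => fderiv ℝ Y₂ p.1) _ (q, v) :=
    (hdd₂ q).hasFDerivAt.comp (q, v) hasFDerivAt_fst
  have hbracket : HasFDerivAt (fun p : E × E => (-Y₂ p.1, fderiv ℝ Y₂ p.1 p.2)) _ (q, v) :=
    hbase.neg.prodMk (hfiber.clm_apply hasFDerivAt_snd)
  rw [lieBracket_flatSpray_verticalLift hd₂, VectorField.lieBracket, hlift.fderiv,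
    hbracket.fderiv]
  simp
end

section
/- Let E be a finite-dimensional real normed vector space and let X, W: E × E → E be C¹ maps (vector fields along the projection E × E → E). Define on E × E the vector fields Z(q,v) = (v,0), X^H(q,v) = (X(q,v), 0), and W^V(q,v) = (0, W(q,v)). Then [Z, X^H + W^V](q,v) = (D₁X_{(q,v)}(v) − W(q,v), D₁W_{(q,v)}(v)) for all (q,v) ∈ E × E, where D₁ denotes the partial Fréchet derivative with respect to the first (base) variable. -/
/-- The partial derivative in the first variable is the total derivative in the direction
`(u, 0)`. -/
theorem fderiv_comp_prodMk_left_apply {𝕜 E F G : Type*} [NontriviallyNormedField 𝕜]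
    [NormedAddCommGroup E] [NormedSpace 𝕜 E] [NormedAddCommGroup F] [NormedSpace 𝕜 F]
    [NormedAddCommGroup G] [NormedSpace 𝕜 G] {f : E × F → G} {x : E} {y : F}
    (hf : DifferentiableAt 𝕜 f (x, y)) (u : E) :
    fderiv 𝕜 (fun a : E => f (a, y)) x u = fderiv 𝕜 f (x, y) (u, 0) := by
  have h : HasFDerivAt (fun a : E => f (a, y))
      ((fderiv 𝕜 f (x, y)).comp (ContinuousLinearMap.inl 𝕜 E F)) x :=
    HasFDerivAt.comp x hf.hasFDerivAt (hasFDerivAt_prodMk_left x y)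
  simp [h.fderiv]


/-- Velocity-dependent flat-connection bracket formula for vector fields along the tangent
bundle projection: `[Z, X^H + W^V](q,v) = (D₁X_{(q,v)} v − W (q,v), D₁W_{(q,v)} v)`. -/
theorem stmt_14 {E : Type*} [NormedAddCommGroup E] [NormedSpace ℝ E] [FiniteDimensional ℝ E]
    (X W : E × E → E) (hX : ContDiff ℝ 1 X) (hW : ContDiff ℝ 1 W) (q v : E) :
    VectorField.lieBracket ℝ (fun p : E × E => (p.2, (0 : E)))
      (fun p : E × E => ((X p, (0 : E)) + ((0 : E), W p))) (q, v)
      = (fderiv ℝ (fun a : E => X (a, v)) q v - W (q, v),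
         fderiv ℝ (fun a : E => W (a, v)) q v) := by
  have hX' : DifferentiableAt ℝ X (q, v) := hX.differentiable one_ne_zero _
  have hW' : DifferentiableAt ℝ W (q, v) := hW.differentiable one_ne_zero _
  have hZ : HasFDerivAt (fun p : E × E => (p.2, (0 : E)))
      ((ContinuousLinearMap.snd ℝ E E).prod 0) (q, v) :=
    hasFDerivAt_snd.prodMk (hasFDerivAt_const 0 _)
  have hXW : HasFDerivAt (fun p : E × E => ((X p, (0 : E)) + ((0 : E), W p)))
      ((fderiv ℝ X (q, v)).prod (fderiv ℝ W (q, v))) (q, v) := by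
    simpa using hX'.hasFDerivAt.prodMk hW'.hasFDerivAt
  rw [VectorField.lieBracket, hZ.fderiv, hXW.fderiv, fderiv_comp_prodMk_left_apply hX',
    fderiv_comp_prodMk_left_apply hW']
  simp
end

section
/- Let m, J, h be real numbers with m ≠ 0, J ≠ 0 and h ≠ 0. On ℝ³ with coordinates (θ, x, y), define Y_1(θ,x,y) = (0, cos θ / m, sin θ / m) and Y_2(θ,x,y) = (−h/J, −sin θ / m, cos θ / m), and let ⟨Y_1 : Y_2⟩ be their symmetric product with respect to the flat connection. Then for every point q ∈ ℝ³, the three vectors Y_1(q), Y_2(q), ⟨Y_1 : Y_2⟩(q) span ℝ³. -/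
/-- The directional derivative of a map depending only on the `i`-th coordinate. -/
theorem fderiv_comp_coord {ι E : Type*} [Fintype ι] [NormedAddCommGroup E] [NormedSpace ℝ E]
    {f : ℝ → E} {f' : E} (i : ι) (q v : ι → ℝ) (hf : HasDerivAt f f' (q i)) :
    fderiv ℝ (fun q : ι → ℝ => f (q i)) q v = v i • f' := by
  have h := hf.hasFDerivAt.comp q (hasFDerivAt_apply (𝕜 := ℝ) i q)
  have h' : fderiv ℝ (fun q : ι → ℝ => f (q i)) q = _ := h.fderiv
  rw [h']
  simp

/-- Planar rigid body with variable-direction thruster: at every configuration `q`, the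
vectors `Y₁ q`, `Y₂ q` and the symmetric product `⟨Y₁ : Y₂⟩ q` (with respect to the flat
connection) span `ℝ³`. -/
theorem stmt_17 (m J h : ℝ) (hm : m ≠ 0) (hJ : J ≠ 0) (hh : h ≠ 0)
    (Y₁ Y₂ : (Fin 3 → ℝ) → (Fin 3 → ℝ))
    (hY₁ : Y₁ = fun q => ![0, Real.cos (q 0) / m, Real.sin (q 0) / m])
    (hY₂ : Y₂ = fun q => ![-h / J, -Real.sin (q 0) / m, Real.cos (q 0) / m]) :
    ∀ q : Fin 3 → ℝ,
      Submodule.span ℝ {Y₁ q, Y₂ q, fderiv ℝ Y₂ q (Y₁ q) + fderiv ℝ Y₁ q (Y₂ q)} = ⊤ := by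
  intro q
  have hd₁ : HasDerivAt (fun t : ℝ => ![0, Real.cos t / m, Real.sin t / m])
      ![0, -Real.sin (q 0) / m, Real.cos (q 0) / m] (q 0) := by
    rw [hasDerivAt_pi]
    intro i
    fin_cases i
    · exact hasDerivAt_const _ _
    · exact (Real.hasDerivAt_cos _).div_const m
    · exact (Real.hasDerivAt_sin _).div_const m
  have hd₂ : HasDerivAt (fun t : ℝ => ![-h / J, -Real.sin t / m, Real.cos t / m])
      ![0, -Real.cos (q 0) / m, -Real.sin (q 0) / m] (q 0) := by
    rw [hasDerivAt_pi]
    intro i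
    fin_cases i
    · exact hasDerivAt_const _ _
    · exact (Real.hasDerivAt_sin _).neg.div_const m
    · exact (Real.hasDerivAt_cos _).div_const m
  have hS : fderiv ℝ Y₂ q (Y₁ q) + fderiv ℝ Y₁ q (Y₂ q) =
      (-h / J) • ![0, -Real.sin (q 0) / m, Real.cos (q 0) / m] := by
    have e₂ : fderiv ℝ Y₂ q (Y₁ q) = _ := hY₂ ▸ fderiv_comp_coord 0 q (Y₁ q) hd₂
    have e₁ : fderiv ℝ Y₁ q (Y₂ q) = _ := hY₁ ▸ fderiv_comp_coord 0 q (Y₂ q) hd₁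
    rw [e₁, e₂, hY₁, hY₂]
    simp
  rw [hS, hY₁, hY₂, eq_top_iff]
  intro v _
  rw [Submodule.mem_span_triple]
  have hsc := Real.sin_sq_add_cos_sq (q 0)
  refine ⟨m * (v 1 * Real.cos (q 0) + v 2 * Real.sin (q 0)), -(v 0 * J / h),
    (m * (v 2 * Real.cos (q 0) - v 1 * Real.sin (q 0)) + v 0 * J / h) * (-(J / h)), ?_⟩
  ext i
  fin_cases i
  · simp
    field_simp
  · simp
    field_simp
    linear_combination (m * h * v 1) * hsc
  · simp
    field_simp
    linear_combination (m * h * v 2) * hsc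
end

section
/- Let ρ be a nonzero real number. On ℝ⁴ with coordinates (x, y, θ, φ), define X_1(x,y,θ,φ) = (ρ cos θ, ρ sin θ, 0, 1) and X_2(x,y,θ,φ) = (0, 0, 1, 0). Then at every point q ∈ ℝ⁴, the four vectors X_1(q), X_2(q), [X_2, X_1](q), [X_2, [X_2, X_1]](q) span ℝ⁴. -/
/-- The Lie bracket of the `i`-th coordinate field with a field depending only on the `i`-th
coordinate is the derivative of the latter in that coordinate. -/
theorem lieBracket_single_comp_eval {ι : Type*} [Fintype ι] [DecidableEq ι] (i : ι)
    {f : ℝ → ι → ℝ} {f' : ι → ℝ} {q : ι → ℝ} (hf : HasDerivAt f f' (q i)) :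
    VectorField.lieBracket ℝ (fun _ => Pi.single i 1) (fun p => f (p i)) q = f' := by
  have h : HasFDerivAt (fun p : ι → ℝ => f (p i)) _ q :=
    hf.hasFDerivAt.comp q (hasFDerivAt_apply i q)
  simp [VectorField.lieBracket_eq, h.fderiv]

/-- Rolling disk: at every point `q ∈ ℝ⁴`, the vectors `X₁ q`, `X₂ q`, `[X₂, X₁] q` and
`[X₂, [X₂, X₁]] q` span `ℝ⁴`. -/
theorem stmt_19 (ρ : ℝ) (hρ : ρ ≠ 0) (X₁ X₂ : (Fin 4 → ℝ) → (Fin 4 → ℝ))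
    (hX₁ : X₁ = fun q => ![ρ * Real.cos (q 2), ρ * Real.sin (q 2), 0, 1])
    (hX₂ : X₂ = fun q => ![0, 0, 1, 0]) :
    ∀ q : Fin 4 → ℝ,
      Submodule.span ℝ
        {X₁ q, X₂ q, VectorField.lieBracket ℝ X₂ X₁ q,
          VectorField.lieBracket ℝ X₂ (VectorField.lieBracket ℝ X₂ X₁) q} = ⊤ := by
  intro q
  have hX₂' : X₂ = fun _ => Pi.single 2 1 := by
    rw [hX₂]
    funext _ i
    fin_cases i <;> simp
  have h₁ : VectorField.lieBracket ℝ X₂ X₁ =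
      fun p => ![-(ρ * Real.sin (p 2)), ρ * Real.cos (p 2), 0, 0] := by
    funext p
    rw [hX₂', hX₁]
    refine lieBracket_single_comp_eval 2
      (f := fun t => ![ρ * Real.cos t, ρ * Real.sin t, 0, 1]) (hasDerivAt_pi.2 fun i => ?_)
    fin_cases i
    · simpa using (Real.hasDerivAt_cos (p 2)).const_mul ρ
    · simpa using (Real.hasDerivAt_sin (p 2)).const_mul ρ
    · simpa using hasDerivAt_const (p 2) (0 : ℝ)
    · simpa using hasDerivAt_const (p 2) (1 : ℝ)
  have h₂ : VectorField.lieBracket ℝ X₂ (VectorField.lieBracket ℝ X₂ X₁) q =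
      ![-(ρ * Real.cos (q 2)), -(ρ * Real.sin (q 2)), 0, 0] := by
    rw [h₁, hX₂']
    refine lieBracket_single_comp_eval 2
      (f := fun t => ![-(ρ * Real.sin t), ρ * Real.cos t, 0, 0]) (hasDerivAt_pi.2 fun i => ?_)
    fin_cases i
    · simpa using ((Real.hasDerivAt_sin (q 2)).const_mul ρ).fun_neg
    · simpa using (Real.hasDerivAt_cos (q 2)).const_mul ρ
    · simpa using hasDerivAt_const (q 2) (0 : ℝ)
    · simpa using hasDerivAt_const (q 2) (0 : ℝ)
  rw [h₂, h₁, hX₁, hX₂, Submodule.eq_top_iff']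
  intro w
  simp only [Submodule.mem_span_insert, Submodule.mem_span_singleton]
  have hsc := Real.sin_sq_add_cos_sq (q 2)
  refine ⟨w 3, _, ⟨w 2, _, ⟨(-Real.sin (q 2) * w 0 + Real.cos (q 2) * w 1) / ρ, _,
    ⟨w 3 - (Real.cos (q 2) * w 0 + Real.sin (q 2) * w 1) / ρ, rfl⟩, rfl⟩, rfl⟩, ?_⟩
  funext i
  fin_cases i <;> simp <;> field_simp
  · linear_combination (-w 0) * hsc
  · linear_combination (-w 1) * hsc
end
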